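/- Let d, m, n ≥ 1, γ_1,…,γ_m > −d, ω_i ∈ W_{γ_i}, 1 ≤ q_i < ∞ with 1/q = 1/q_1+⋯+1/q_m ≤ 1, and ω = ∏_{i=1}^m ω_i^{q/q_i}. Let ψ : [0,1]^n → [0,∞) be measurable and s_1,…,s_m : [0,1]^n → ℝ measurable with s_i(t) ≠ 0 for almost every t. For t with all s_i(t) ≠ 0, let ℓ_i(t) be the unique integer with 2^{ℓ_i(t)−1} < |s_i(t)| ≤ 2^{ℓ_i(t)}. Then for every k ∈ ℤ and all measurable f_1,…,f_m, ‖U^{m,n}_{ψ,s}(f_1,…,f_m) χ_k‖_{q,ω} ≤ ∫_{[0,1]^n} ∏_{i=1}^m (‖f_i χ_{k+ℓ_i(t)−1}‖_{q_i,ω_i} + ‖f_i χ_{k+ℓ_i(t)}‖_{q_i,ω_i}) · (∏_{i=1}^m |s_i(t)|^{−(d+γ_i)/q_i}) ψ(t) dt. -/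

import Mathlib

open MeasureTheory ENNReal Set

noncomputable section

/-- Euclidean space `ℝ^d`. -/
abbrev Ed (d : ℕ) := EuclideanSpace ℝ (Fin d)

/-- The dyadic annulus `C_k = B_k \ B_{k-1}` where `B_k = {x : ‖x‖ ≤ 2^k}`. -/
def annulus (d : ℕ) (k : ℤ) : Set (Ed d) :=
  {x : Ed d | ‖x‖ ≤ (2 : ℝ) ^ k} \ {x : Ed d | ‖x‖ ≤ (2 : ℝ) ^ (k - 1)}

/-- `‖f χ_k‖_{q,ω} = (∫_{C_k} |f|^q ω)^{1/q}`. -/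
def pieceNorm (d : ℕ) (q : ℝ) (ω : Ed d → ℝ) (f : Ed d → ℂ) (k : ℤ) : ℝ≥0∞ :=
  (∫⁻ x in annulus d k, (‖f x‖₊ : ℝ≥0∞) ^ q * ENNReal.ofReal (ω x)) ^ (1 / q)

/-- The weighted Morrey–Herz norm `‖f‖_{MK̇^{α,lam}_{p,q}(ω)}`. -/
def morreyHerzNorm (d : ℕ) (α lam p q : ℝ) (ω : Ed d → ℝ) (f : Ed d → ℂ) : ℝ≥0∞ :=
  ⨆ k₀ : ℤ, ENNReal.ofReal ((2 : ℝ) ^ (-(k₀ : ℝ) * lam)) *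
    (∑' k : {k : ℤ // k ≤ k₀},
        ENNReal.ofReal ((2 : ℝ) ^ (((k : ℤ) : ℝ) * α * p)) *
          pieceNorm d q ω f (k : ℤ) ^ p) ^ (1 / p)

/-- The weighted homogeneous Herz norm `‖f‖_{K̇^{α,p}_q(ω)}`. -/
def herzNorm (d : ℕ) (α p q : ℝ) (ω : Ed d → ℝ) (f : Ed d → ℂ) : ℝ≥0∞ :=
  (∑' k : ℤ, ENNReal.ofReal ((2 : ℝ) ^ ((k : ℝ) * α * p)) * pieceNorm d q ω f k ^ p) ^ (1 / p)

/-- `∫_{S_d} ω dσ`, the integral of a weight over the unit sphere with respect to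
the surface measure. -/
def sphereInt (d : ℕ) (ω : Ed d → ℝ) : ℝ≥0∞ :=
  ∫⁻ θ : Metric.sphere (0 : Ed d) 1, ENNReal.ofReal (ω θ)
    ∂((volume : Measure (Ed d)).toSphere)

/-- The class `W_γ` of absolutely homogeneous weights of degree `γ`. -/
structure IsWeight (d : ℕ) (γ : ℝ) (ω : Ed d → ℝ) : Prop where
  measurable : Measurable ω
  nonneg : ∀ x, 0 ≤ ω x
  pos : ∀ᵐ x ∂(volume : Measure (Ed d)), 0 < ω x
  homog : ∀ t : ℝ, t ≠ 0 → ∀ x : Ed d, ω (t • x) = |t| ^ γ * ω x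
  sphere_pos : 0 < sphereInt d ω
  sphere_lt_top : sphereInt d ω < ⊤

/-- The unit cube `[0,1]^n`. -/
def cube (n : ℕ) : Set (Fin n → ℝ) := Set.Icc 0 1

/-- The weighted multilinear Hardy–Cesàro operator `U^{m,n}_{ψ,s}`. -/
def hardyCesaro (d m n : ℕ) (ψ : (Fin n → ℝ) → ℝ) (s : Fin m → (Fin n → ℝ) → ℝ)
    (f : Fin m → Ed d → ℂ) (x : Ed d) : ℂ :=
  ∫ t in cube n, (∏ i, f i (s i t • x)) * (ψ t : ℂ)

/-- The commutator `U^{m,n,b}_{ψ,s}` of the weighted multilinear Hardy–Cesàro operator. -/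
def hardyCesaroComm (d m n : ℕ) (ψ : (Fin n → ℝ) → ℝ) (s : Fin m → (Fin n → ℝ) → ℝ)
    (b : Fin m → Ed d → ℂ) (f : Fin m → Ed d → ℂ) (x : Ed d) : ℂ :=
  ∫ t in cube n, (∏ i, f i (s i t • x)) * (∏ i, (b i x - b i (s i t • x))) * (ψ t : ℂ)

/-- The Lipschitz seminorm `‖b‖_{Lip^β}`. -/
def lipNorm (d : ℕ) (β : ℝ) (b : Ed d → ℂ) : ℝ :=
  ⨆ pr : {pr : Ed d × Ed d // pr.1 ≠ pr.2}, ‖b pr.1.1 - b pr.1.2‖ / ‖pr.1.1 - pr.1.2‖ ^ β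

/-- Membership in the Lipschitz space `Lip^β(ℝ^d)`. -/
def MemLip (d : ℕ) (β : ℝ) (b : Ed d → ℂ) : Prop :=
  ∃ C : ℝ, ∀ x y : Ed d, ‖b x - b y‖ ≤ C * ‖x - y‖ ^ β

/-- Minkowski's integral inequality for a minorant of the inner integral that has finite
`p`-th moment. -/
lemma lintegral_rpow_le_of_le_lintegral {α β : Type*} [MeasurableSpace α] [MeasurableSpace β]
    {μ : Measure α} {ν : Measure β} [SFinite μ] [SFinite ν] {p : ℝ} (hp : 1 < p)
    {F : α → β → ℝ≥0∞} (hF : Measurable (Function.uncurry F))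
    {g : α → ℝ≥0∞} (hg : Measurable g) (hgF : ∀ x, g x ≤ ∫⁻ y, F x y ∂ν)
    (hfin : ∫⁻ x, g x ^ p ∂μ ≠ ⊤) :
    (∫⁻ x, g x ^ p ∂μ) ^ (1 / p) ≤ ∫⁻ y, (∫⁻ x, F x y ^ p ∂μ) ^ (1 / p) ∂ν := by
  set I := ∫⁻ x, g x ^ p ∂μ with hI
  have hp0 : 0 < p := by linarith
  have hpq := Real.HolderConjugate.conjExponent hp
  set p' := p.conjExponent with hp'
  rcases eq_or_ne I 0 with h0 | h0
  · rw [h0, ENNReal.zero_rpow_of_pos (by positivity)]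
    exact zero_le
  have key : I ≤ (∫⁻ y, (∫⁻ x, F x y ^ p ∂μ) ^ (1 / p) ∂ν) * I ^ (1 / p') := by
    calc I ≤ ∫⁻ x, ∫⁻ y, F x y * g x ^ (p - 1) ∂ν ∂μ := by
          refine lintegral_mono fun x => ?_
          have hFx : Measurable (F x) := hF.comp measurable_prodMk_left
          rw [lintegral_mul_const _ hFx]
          calc g x ^ p = g x ^ (1 + (p - 1)) := by congr 1; ring
            _ = g x * g x ^ (p - 1) := by
              rw [ENNReal.rpow_add_of_nonneg _ _ zero_le_one (by linarith), ENNReal.rpow_one]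
            _ ≤ _ := by gcongr; exact hgF x
      _ = ∫⁻ y, ∫⁻ x, F x y * g x ^ (p - 1) ∂μ ∂ν := by
          refine lintegral_lintegral_swap (Measurable.aemeasurable ?_)
          exact hF.mul ((hg.pow_const _).comp measurable_fst)
      _ ≤ ∫⁻ y, (∫⁻ x, F x y ^ p ∂μ) ^ (1 / p) * I ^ (1 / p') ∂ν := by
          refine lintegral_mono fun y => ?_
          have hFy : Measurable fun x => F x y := hF.comp measurable_prodMk_right
          refine (ENNReal.lintegral_mul_le_Lp_mul_Lq μ hpq hFy.aemeasurable
            (hg.pow_const (p - 1)).aemeasurable).trans_eq ?_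
          simp_rw [← ENNReal.rpow_mul, hpq.sub_one_mul_conj]
          rfl
      _ = _ := lintegral_mul_const' _ _
          (ENNReal.rpow_ne_top_of_nonneg (one_div_nonneg.2 hpq.symm.nonneg) hfin)
  have hsplit : I = I ^ (1 / p) * I ^ (1 / p') := by
    rw [← ENNReal.rpow_add _ _ h0 hfin, one_div, one_div, hpq.inv_add_inv_eq_one,
      ENNReal.rpow_one]
  exact (ENNReal.mul_le_mul_iff_left (ENNReal.rpow_pos (pos_iff_ne_zero.2 h0) hfin).ne'
    (ENNReal.rpow_ne_top_of_nonneg (one_div_nonneg.2 hpq.symm.nonneg) hfin)).1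
    (hsplit.symm.le.trans key)

/-- **Minkowski's integral inequality.** -/
lemma lintegral_lintegral_rpow_le {α β : Type*} [MeasurableSpace α] [MeasurableSpace β]
    {μ : Measure α} {ν : Measure β} [SigmaFinite μ] [SFinite ν] {p : ℝ} (hp : 1 ≤ p)
    {F : α → β → ℝ≥0∞} (hF : Measurable (Function.uncurry F)) :
    (∫⁻ x, (∫⁻ y, F x y ∂ν) ^ p ∂μ) ^ (1 / p) ≤
      ∫⁻ y, (∫⁻ x, F x y ^ p ∂μ) ^ (1 / p) ∂ν := by
  rcases hp.eq_or_lt with rfl | hp1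
  · simpa using (lintegral_lintegral_swap hF.aemeasurable).le
  have hp0 : 0 < p := by linarith
  set G : α → ℝ≥0∞ := fun x => ∫⁻ y, F x y ∂ν with hGdef
  have hG : Measurable G := hF.lintegral_prod_right
  let g : ℕ → α → ℝ≥0∞ := fun N => (spanningSets μ N).indicator fun x => min (G x) N
  have hg : ∀ N, Measurable (g N) := fun N =>
    (hG.min measurable_const).indicator (measurableSet_spanningSets μ N)
  have hgG : ∀ N x, g N x ≤ G x := fun N x =>
    indicator_apply_le' (fun _ => min_le_left _ _) fun _ => zero_le
  have hfin : ∀ N, ∫⁻ x, g N x ^ p ∂μ ≠ ⊤ := by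
    intro N
    have hle : ∀ x, g N x ^ p ≤ (spanningSets μ N).indicator (fun _ => (N : ℝ≥0∞) ^ p) x := by
      intro x
      by_cases hx : x ∈ spanningSets μ N
      · simp only [g, indicator_of_mem hx]
        gcongr
        exact min_le_right _ _
      · simp [g, indicator_of_notMem hx, ENNReal.zero_rpow_of_pos hp0]
    refine ((lintegral_mono hle).trans_lt ?_).ne
    rw [lintegral_indicator_const (measurableSet_spanningSets μ N)]
    exact ENNReal.mul_lt_top
      (ENNReal.rpow_lt_top_of_nonneg hp0.le (ENNReal.natCast_ne_top N))
      (measure_spanningSets_lt_top μ N)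
  have hlim : ∀ x, Filter.Tendsto (fun N => g N x ^ p) Filter.atTop (nhds (G x ^ p)) := by
    intro x
    refine (ENNReal.continuous_rpow_const.tendsto _).comp ?_
    have h1 : Filter.Tendsto (fun N : ℕ => min (G x) (N : ℝ≥0∞)) Filter.atTop (nhds (G x)) := by
      simpa using (tendsto_const_nhds (x := G x)).min ENNReal.tendsto_nat_nhds_top
    refine h1.congr' ?_
    filter_upwards [Filter.eventually_ge_atTop (spanningSetsIndex μ x)] with N hN
    simp only [g, indicator_of_mem (mem_spanningSets_of_index_le μ x hN)]
  have hbound : ∀ N, ∫⁻ x, g N x ^ p ∂μ ≤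
      (∫⁻ y, (∫⁻ x, F x y ^ p ∂μ) ^ (1 / p) ∂ν) ^ p := by
    intro N
    have := lintegral_rpow_le_of_le_lintegral hp1 hF (hg N) (hgG N) (hfin N)
    rwa [one_div, ENNReal.rpow_inv_le_iff hp0, ← one_div] at this
  rw [one_div, ENNReal.rpow_inv_le_iff hp0, ← one_div]
  calc ∫⁻ x, G x ^ p ∂μ = ∫⁻ x, Filter.liminf (fun N => g N x ^ p) Filter.atTop ∂μ := by
        simp_rw [fun x => (hlim x).liminf_eq]
    _ ≤ Filter.liminf (fun N => ∫⁻ x, g N x ^ p ∂μ) Filter.atTop :=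
        lintegral_liminf_le fun N => (hg N).pow_const p
    _ ≤ Filter.liminf (fun _ : ℕ => (∫⁻ y, (∫⁻ x, F x y ^ p ∂μ) ^ (1 / p) ∂ν) ^ p)
          Filter.atTop := Filter.liminf_le_liminf (Filter.Eventually.of_forall hbound)
    _ = _ := Filter.liminf_const _

lemma measurableSet_annulus (d : ℕ) (k : ℤ) : MeasurableSet (annulus d k) :=
  (measurableSet_le measurable_norm measurable_const).diff
    (measurableSet_le measurable_norm measurable_const)

lemma smul_mem_annulus_union {d : ℕ} {k l : ℤ} {a : ℝ} {x : Ed d} (hx : x ∈ annulus d k)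
    (ha : (2 : ℝ) ^ (l - 1) < |a|) (ha' : |a| ≤ (2 : ℝ) ^ l) :
    a • x ∈ annulus d (k + l - 1) ∪ annulus d (k + l) := by
  obtain ⟨hx1, hx2⟩ := hx
  simp only [mem_ofPred_eq, not_le] at hx1 hx2
  have hupper : ‖a • x‖ ≤ (2 : ℝ) ^ (k + l) := by
    rw [norm_smul, Real.norm_eq_abs, add_comm, zpow_add₀ two_ne_zero]
    gcongr
  have hlower : (2 : ℝ) ^ (k + l - 1 - 1) < ‖a • x‖ := by
    rw [norm_smul, Real.norm_eq_abs, show k + l - 1 - 1 = (l - 1) + (k - 1) by ring,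
      zpow_add₀ two_ne_zero]
    gcongr
  by_cases h : ‖a • x‖ ≤ (2 : ℝ) ^ (k + l - 1)
  · exact Or.inl ⟨h, not_le.2 hlower⟩
  · exact Or.inr ⟨hupper, h⟩

lemma lintegral_comp_smul_eq {d : ℕ} {a : ℝ} (ha : a ≠ 0) {h : Ed d → ℝ≥0∞}
    (hh : Measurable h) :
    ∫⁻ x, h (a • x) = ENNReal.ofReal (|a| ^ (-(d : ℝ))) * ∫⁻ x, h x := by
  rw [← lintegral_map hh (measurable_const_smul a), Measure.map_addHaar_smul _ ha,
    lintegral_smul_measure, finrank_euclideanSpace_fin, smul_eq_mul, abs_inv, abs_pow,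
    Real.rpow_neg (abs_nonneg a), Real.rpow_natCast]

/-- The piece norm over `C_k` of a dilate, controlled by piece norms of the function itself. -/
lemma pieceNorm_comp_smul_le {d : ℕ} {γ q : ℝ} {ω : Ed d → ℝ} (hω : IsWeight d γ ω)
    (hq : 1 ≤ q) {f : Ed d → ℂ} (hf : Measurable f) {k l : ℤ} {a : ℝ} (ha0 : a ≠ 0)
    (ha : (2 : ℝ) ^ (l - 1) < |a|) (ha' : |a| ≤ (2 : ℝ) ^ l) :
    pieceNorm d q ω (fun x => f (a • x)) k ≤
      (pieceNorm d q ω f (k + l - 1) + pieceNorm d q ω f (k + l)) *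
        ENNReal.ofReal (|a| ^ (-((d : ℝ) + γ) / q)) := by
  have hq0 : 0 < q := by linarith
  have hapos : 0 < |a| := abs_pos.2 ha0
  set φ : Ed d → ℝ≥0∞ := fun y => (‖f y‖₊ : ℝ≥0∞) ^ q * ENNReal.ofReal (ω y) with hφdef
  have hφ : Measurable φ := (hf.enorm.pow_const q).mul hω.measurable.ennreal_ofReal
  set A := annulus d (k + l - 1) ∪ annulus d (k + l) with hA
  have hAm : MeasurableSet A := (measurableSet_annulus d _).union (measurableSet_annulus d _)
  have hscale : ∀ x, (‖f (a • x)‖₊ : ℝ≥0∞) ^ q * ENNReal.ofReal (ω x) =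
      ENNReal.ofReal (|a| ^ (-γ)) * φ (a • x) := by
    intro x
    have hωx : ω x = |a| ^ (-γ) * ω (a • x) := by
      rw [hω.homog a ha0, ← mul_assoc, ← Real.rpow_add hapos]
      simp
    rw [hωx, ENNReal.ofReal_mul (by positivity), hφdef]
    ring
  have hint : ∫⁻ x in annulus d k, (‖f (a • x)‖₊ : ℝ≥0∞) ^ q * ENNReal.ofReal (ω x) ≤
      ENNReal.ofReal (|a| ^ (-((d : ℝ) + γ))) *
        ((∫⁻ y in annulus d (k + l - 1), φ y) + ∫⁻ y in annulus d (k + l), φ y) := by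
    calc ∫⁻ x in annulus d k, (‖f (a • x)‖₊ : ℝ≥0∞) ^ q * ENNReal.ofReal (ω x)
        = ENNReal.ofReal (|a| ^ (-γ)) * ∫⁻ x in annulus d k, φ (a • x) := by
          simp_rw [hscale]
          exact lintegral_const_mul _ (hφ.comp (measurable_const_smul a))
      _ ≤ ENNReal.ofReal (|a| ^ (-γ)) * ∫⁻ x, A.indicator φ (a • x) := by
          rw [← lintegral_indicator (measurableSet_annulus d k)]
          gcongr with x
          by_cases hx : x ∈ annulus d k
          · rw [indicator_of_mem hx, indicator_of_mem (smul_mem_annulus_union hx ha ha')]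
          · rw [indicator_of_notMem hx]
            exact zero_le
      _ = ENNReal.ofReal (|a| ^ (-((d : ℝ) + γ))) * ∫⁻ y in A, φ y := by
          rw [lintegral_comp_smul_eq ha0 (hφ.indicator hAm), lintegral_indicator hAm,
            ← mul_assoc, ← ENNReal.ofReal_mul (by positivity), ← Real.rpow_add hapos]
          congr 4
          ring
      _ ≤ _ := mul_le_mul_right (lintegral_union_le _ _ _) _
  calc pieceNorm d q ω (fun x => f (a • x)) k
      ≤ (ENNReal.ofReal (|a| ^ (-((d : ℝ) + γ))) *
        ((∫⁻ y in annulus d (k + l - 1), φ y) + ∫⁻ y in annulus d (k + l), φ y)) ^ (1 / q) := by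
        unfold pieceNorm
        gcongr
    _ = ((∫⁻ y in annulus d (k + l - 1), φ y) + ∫⁻ y in annulus d (k + l), φ y) ^ (1 / q) *
        ENNReal.ofReal (|a| ^ (-((d : ℝ) + γ) / q)) := by
        rw [ENNReal.mul_rpow_of_nonneg _ _ (by positivity), mul_comm,
          ENNReal.ofReal_rpow_of_nonneg (by positivity) (by positivity), ← Real.rpow_mul hapos.le,
          mul_one_div]
    _ ≤ _ := by
        refine mul_le_mul_left ?_ _
        exact ENNReal.rpow_add_le_add_rpow _ _ (by positivity) ((div_le_one hq0).2 hq)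

/-- Hölder's inequality for piece norms of a product of functions. -/
lemma pieceNorm_prod_le {d : ℕ} {ι : Type*} [Fintype ι] {q : ι → ℝ} (hq : ∀ i, 0 < q i)
    {p : ℝ} (hp : 0 < p) (hpq : 1 / p = ∑ i, 1 / q i) {ω : ι → Ed d → ℝ}
    (hωm : ∀ i, Measurable (ω i)) (hω : ∀ i x, 0 ≤ ω i x) {g : ι → Ed d → ℂ}
    (hg : ∀ i, Measurable (g i)) (k : ℤ) :
    pieceNorm d p (fun x => ∏ i, ω i x ^ (p / q i)) (fun x => ∏ i, g i x) k ≤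
      ∏ i, pieceNorm d (q i) (ω i) (g i) k := by
  have hsum : ∑ i, p / q i = 1 := by
    simp_rw [div_eq_mul_one_div p]
    rw [← Finset.mul_sum, ← hpq, mul_one_div_cancel hp.ne']
  have hpt : ∀ x, (‖∏ i, g i x‖₊ : ℝ≥0∞) ^ p * ENNReal.ofReal (∏ i, ω i x ^ (p / q i)) =
      ∏ i, ((‖g i x‖₊ : ℝ≥0∞) ^ q i * ENNReal.ofReal (ω i x)) ^ (p / q i) := by
    intro x
    rw [nnnorm_prod, ENNReal.ofNNReal_finsetProd, ← ENNReal.prod_rpow_of_nonneg hp.le,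
      ENNReal.ofReal_prod_of_nonneg fun i _ => Real.rpow_nonneg (hω i x) _,
      ← Finset.prod_mul_distrib]
    refine Finset.prod_congr rfl fun i _ => ?_
    have hpi : 0 ≤ p / q i := (div_pos hp (hq i)).le
    rw [ENNReal.mul_rpow_of_nonneg _ _ hpi, ← ENNReal.rpow_mul, mul_div_cancel₀ _ (hq i).ne',
      ENNReal.ofReal_rpow_of_nonneg (hω i x) hpi]
  unfold pieceNorm
  simp_rw [hpt]
  calc _ ≤ (∏ i, (∫⁻ x in annulus d k,
          (‖g i x‖₊ : ℝ≥0∞) ^ q i * ENNReal.ofReal (ω i x)) ^ (p / q i)) ^ (1 / p) := by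
        gcongr
        exact ENNReal.lintegral_prod_norm_pow_le _
          (fun i _ => (((hg i).enorm.pow_const _).mul (hωm i).ennreal_ofReal).aemeasurable)
          hsum (fun i _ => (div_pos hp (hq i)).le)
    _ = _ := by
        rw [← ENNReal.prod_rpow_of_nonneg (by positivity)]
        refine Finset.prod_congr rfl fun i _ => ?_
        rw [← ENNReal.rpow_mul]
        congr 1
        field_simp

/-- Minkowski's integral inequality for piece norms. -/
lemma pieceNorm_integral_le {d : ℕ} {β : Type*} [MeasurableSpace β] {ν : Measure β} [SFinite ν]
    {p : ℝ} (hp : 1 ≤ p) {w : Ed d → ℝ} (hw : Measurable w) {F : Ed d → β → ℂ}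
    (hF : Measurable (Function.uncurry F)) (k : ℤ) :
    pieceNorm d p w (fun x => ∫ t, F x t ∂ν) k ≤
      ∫⁻ t, pieceNorm d p w (fun x => F x t) k ∂ν := by
  have hp0 : 0 < p := by linarith
  set μ := (volume.restrict (annulus d k)).withDensity fun x => ENNReal.ofReal (w x) with hμ
  have hdens : ∀ h : Ed d → ℝ≥0∞, Measurable h →
      ∫⁻ x, h x ∂μ = ∫⁻ x in annulus d k, h x * ENNReal.ofReal (w x) := by
    intro h hh
    rw [hμ, lintegral_withDensity_eq_lintegral_mul _ hw.ennreal_ofReal hh]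
    simp only [Pi.mul_apply, mul_comm]
  have hFn : Measurable (Function.uncurry fun x t => ‖F x t‖ₑ) := hF.enorm
  calc pieceNorm d p w (fun x => ∫ t, F x t ∂ν) k
      ≤ (∫⁻ x in annulus d k, (∫⁻ t, ‖F x t‖ₑ ∂ν) ^ p * ENNReal.ofReal (w x)) ^ (1 / p) := by
        unfold pieceNorm
        gcongr
        exact enorm_integral_le_lintegral_enorm _
    _ = (∫⁻ x, (∫⁻ t, ‖F x t‖ₑ ∂ν) ^ p ∂μ) ^ (1 / p) := by
        rw [hdens _ (hFn.lintegral_prod_right.pow_const p)]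
    _ ≤ ∫⁻ t, (∫⁻ x, ‖F x t‖ₑ ^ p ∂μ) ^ (1 / p) ∂ν := lintegral_lintegral_rpow_le hp hFn
    _ = _ := by
        refine lintegral_congr fun t => ?_
        have hFt : Measurable fun x => ‖F x t‖ₑ := hFn.comp measurable_prodMk_right
        rw [hdens _ (hFt.pow_const p)]
        rfl

lemma pieceNorm_mul_const {d : ℕ} {p : ℝ} (hp : 0 < p) (w : Ed d → ℝ) (g : Ed d → ℂ) (c : ℂ)
    (k : ℤ) : pieceNorm d p w (fun x => g x * c) k = pieceNorm d p w g k * ‖c‖ₑ := by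
  unfold pieceNorm
  have hpt : ∀ x, (‖g x * c‖₊ : ℝ≥0∞) ^ p * ENNReal.ofReal (w x) =
      ((‖g x‖₊ : ℝ≥0∞) ^ p * ENNReal.ofReal (w x)) * ‖c‖ₑ ^ p := by
    intro x
    rw [nnnorm_mul, ENNReal.coe_mul, ENNReal.mul_rpow_of_nonneg _ _ hp.le, mul_right_comm]
    rfl
  simp_rw [hpt]
  rw [lintegral_mul_const' _ _ (ENNReal.rpow_ne_top_of_nonneg hp.le enorm_ne_top),
    ENNReal.mul_rpow_of_nonneg _ _ (by positivity), ← ENNReal.rpow_mul,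
    mul_one_div_cancel hp.ne', ENNReal.rpow_one]

/-- The basic annulus estimate for the multilinear Hardy–Cesàro operator:
`‖U(f₁,…,f_m) χ_k‖_{q,ω}` is controlled by shifted piece norms of the `fᵢ`. -/
theorem statement16
    (d m n : ℕ) (hd : 1 ≤ d) (hm : 1 ≤ m) (hn : 1 ≤ n)
    (γ : Fin m → ℝ) (hγ : ∀ i, -(d : ℝ) < γ i)
    (ω : Fin m → Ed d → ℝ) (hω : ∀ i, IsWeight d (γ i) (ω i))
    (q : Fin m → ℝ) (hq : ∀ i, 1 ≤ q i)
    (q₀ : ℝ) (hq₀ : 1 / q₀ = ∑ i, 1 / q i) (hq₀sum : (∑ i, 1 / q i) ≤ 1)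
    (w : Ed d → ℝ) (hw : ∀ x, w x = ∏ i, ω i x ^ (q₀ / q i))
    (ψ : (Fin n → ℝ) → ℝ) (hψm : Measurable ψ) (hψ : ∀ t, 0 ≤ ψ t)
    (s : Fin m → (Fin n → ℝ) → ℝ) (hsm : ∀ i, Measurable (s i))
    (hs : ∀ i, ∀ᵐ t ∂(volume.restrict (cube n)), s i t ≠ 0)
    (ℓ : Fin m → (Fin n → ℝ) → ℤ)
    (hℓ : ∀ i t, s i t ≠ 0 →
      (2 : ℝ) ^ (ℓ i t - 1) < |s i t| ∧ |s i t| ≤ (2 : ℝ) ^ (ℓ i t))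
    (k : ℤ) (f : Fin m → Ed d → ℂ) (hfm : ∀ i, Measurable (f i)) :
    pieceNorm d q₀ w (hardyCesaro d m n ψ s f) k ≤
      ∫⁻ t in cube n,
        (∏ i, (pieceNorm d (q i) (ω i) (f i) (k + ℓ i t - 1) +
            pieceNorm d (q i) (ω i) (f i) (k + ℓ i t))) *
          (∏ i, ENNReal.ofReal (|s i t| ^ (-((d : ℝ) + γ i) / q i))) *
            ENNReal.ofReal (ψ t) := by
  have hqpos : ∀ i, 0 < q i := fun i => zero_lt_one.trans_le (hq i)
  have hsum_pos : 0 < 1 / q₀ := by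
    rw [hq₀]
    exact Finset.sum_pos (fun i _ => one_div_pos.2 (hqpos i)) ⟨⟨0, hm⟩, Finset.mem_univ _⟩
  have hq₀pos : 0 < q₀ := one_div_pos.1 hsum_pos
  have hq₀one : 1 ≤ q₀ := (div_le_one hq₀pos).1 (hq₀.trans_le hq₀sum)
  obtain rfl : w = fun x => ∏ i, ω i x ^ (q₀ / q i) := funext hw
  have hwm : Measurable fun x => ∏ i, ω i x ^ (q₀ / q i) :=
    Finset.measurable_fun_prod _ fun i _ => (hω i).measurable.pow_const _
  have hF : Measurable (Function.uncurry fun (x : Ed d) (t : Fin n → ℝ) =>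
      (∏ i, f i (s i t • x)) * (ψ t : ℂ)) := by
    refine Measurable.mul (Finset.measurable_fun_prod _ fun i _ => (hfm i).comp ?_) ?_
    · exact ((hsm i).comp measurable_snd).smul measurable_fst
    · exact Complex.measurable_ofReal.comp (hψm.comp measurable_snd)
  refine (pieceNorm_integral_le hq₀one hwm hF k).trans (lintegral_mono_ae ?_)
  filter_upwards [ae_all_iff.2 hs] with t ht
  rw [pieceNorm_mul_const hq₀pos, ← Finset.prod_mul_distrib, ← ofReal_norm,
    Complex.norm_of_nonneg (hψ t)]
  gcongr
  calc _ ≤ ∏ i, pieceNorm d (q i) (ω i) (fun x => f i (s i t • x)) k :=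
        pieceNorm_prod_le hqpos hq₀pos hq₀ (fun i => (hω i).measurable)
          (fun i => (hω i).nonneg) (fun i => (hfm i).comp (measurable_const_smul (s i t))) k
    _ ≤ _ := Finset.prod_le_prod' fun i _ =>
        pieceNorm_comp_smul_le (hω i) (hq i) (hfm i) (ht i) (hℓ i t (ht i)).1 (hℓ i t (ht i)).2

end
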